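/- (Inf-sup, Lemma 3.3) In the abstract four-field Biot setting with the lifting hypotheses, there exists γ > 0 depending only on α_u, β_r, β_u, β_q (independent of μ, λ, K, δ, c₀, α) such that for every x ∈ X, sup over nonzero x̃ ∈ X of 𝒜(x, x̃)/‖x̃‖_X is at least γ‖x‖_X. -/

import Mathlib

open RealInnerProductSpace

noncomputable section

variable {R U Q P : Type*}
  [NormedAddCommGroup R] [InnerProductSpace ℝ R]
  [NormedAddCommGroup U] [InnerProductSpace ℝ U]
  [NormedAddCommGroup Q] [InnerProductSpace ℝ Q]
  [NormedAddCommGroup P] [InnerProductSpace ℝ P]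

/-- The weight `η + c₀`, where `η := α²/(2μ+λ) + δ²K`. -/
def etaC (μ lam K δ c₀ α : ℝ) : ℝ := α ^ 2 / (2 * μ + lam) + δ ^ 2 * K + c₀

/-- The parameter-weighted norm `‖·‖_X` on `X := R × U × Q × P`. -/
def Xnorm (μ lam K δ c₀ α : ℝ) (C : R →ₗ[ℝ] U) (D : U →ₗ[ℝ] P) (E : Q →ₗ[ℝ] P)
    (x : R × U × Q × P) : ℝ :=
  Real.sqrt (μ⁻¹ * (‖x.1‖ ^ 2 + ‖C x.1‖ ^ 2) + μ * ‖x.2.1‖ ^ 2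
    + (2 * μ + lam) * ‖D x.2.1‖ ^ 2 + K⁻¹ * ‖x.2.2.1‖ ^ 2
    + δ ^ 2 / etaC μ lam K δ c₀ α * ‖E x.2.2.1‖ ^ 2
    + etaC μ lam K δ c₀ α * ‖x.2.2.2‖ ^ 2)

/-- The Biot bilinear form `𝒜` on `X := R × U × Q × P`. -/
def biotForm (μ lam K δ c₀ α : ℝ) (C : R →ₗ[ℝ] U) (D : U →ₗ[ℝ] P) (E : Q →ₗ[ℝ] P)
    (x y : R × U × Q × P) : ℝ :=
  μ⁻¹ * ⟪x.1, y.1⟫ + (2 * μ + lam) * ⟪D x.2.1, D y.2.1⟫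
    + K⁻¹ * ⟪x.2.2.1, y.2.2.1⟫ + c₀ * ⟪x.2.2.2, y.2.2.2⟫
    + ⟪C x.1, y.2.1⟫ + ⟪α • D x.2.1 + δ • E x.2.2.1, y.2.2.2⟫
    - ⟪C y.1, x.2.1⟫ - ⟪α • D y.2.1 + δ • E y.2.2.1, x.2.2.2⟫

section Auxiliary

variable {μ lam K δ c₀ α : ℝ} {C : R →ₗ[ℝ] U} {D : U →ₗ[ℝ] P} {E : Q →ₗ[ℝ] P}

lemma etaC_pos (hμ : 0 < μ) (hlam : 0 < lam) (hK : 0 < K) (hδ : 0 < δ) (hc : 0 ≤ c₀) :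
    0 < etaC μ lam K δ c₀ α := by
  unfold etaC
  positivity

lemma Xnorm_nonneg (x : R × U × Q × P) : 0 ≤ Xnorm μ lam K δ c₀ α C D E x :=
  Real.sqrt_nonneg _

lemma Xnorm_sq (hμ : 0 < μ) (hlam : 0 < lam) (hK : 0 < K) (hδ : 0 < δ) (hc : 0 ≤ c₀)
    (x : R × U × Q × P) :
    Xnorm μ lam K δ c₀ α C D E x ^ 2 =
      μ⁻¹ * (‖x.1‖ ^ 2 + ‖C x.1‖ ^ 2) + μ * ‖x.2.1‖ ^ 2
        + (2 * μ + lam) * ‖D x.2.1‖ ^ 2 + K⁻¹ * ‖x.2.2.1‖ ^ 2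
        + δ ^ 2 / etaC μ lam K δ c₀ α * ‖E x.2.2.1‖ ^ 2
        + etaC μ lam K δ c₀ α * ‖x.2.2.2‖ ^ 2 := by
  have he := etaC_pos (α := α) hμ hlam hK hδ hc
  unfold Xnorm
  exact Real.sq_sqrt (by positivity)

lemma Xnorm_zero : Xnorm μ lam K δ c₀ α C D E (0 : R × U × Q × P) = 0 := by
  simp [Xnorm]

lemma le_inv_sqrt_mul_of_mul_sq_le {k b N : ℝ} (hk : 0 < k) (hN : 0 ≤ N)
    (h : k * b ^ 2 ≤ N ^ 2) : b ≤ (√k)⁻¹ * N := by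
  rw [inv_mul_eq_div, le_div_iff₀ (Real.sqrt_pos.2 hk)]
  refine le_of_sq_le_sq ?_ hN
  rw [mul_pow, Real.sq_sqrt hk.le]
  linarith

/-- Every component of `y`, and its image under `C`, `D` or `E`, is controlled by `‖y‖_X`. -/
lemma exists_norm_le_mul_Xnorm (hμ : 0 < μ) (hlam : 0 < lam) (hK : 0 < K) (hδ : 0 < δ)
    (hc : 0 ≤ c₀) :
    ∃ L : ℝ, ∀ y : R × U × Q × P,
      ‖y.1‖ ≤ L * Xnorm μ lam K δ c₀ α C D E y ∧
      ‖C y.1‖ ≤ L * Xnorm μ lam K δ c₀ α C D E y ∧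
      ‖y.2.1‖ ≤ L * Xnorm μ lam K δ c₀ α C D E y ∧
      ‖D y.2.1‖ ≤ L * Xnorm μ lam K δ c₀ α C D E y ∧
      ‖y.2.2.1‖ ≤ L * Xnorm μ lam K δ c₀ α C D E y ∧
      ‖E y.2.2.1‖ ≤ L * Xnorm μ lam K δ c₀ α C D E y ∧
      ‖y.2.2.2‖ ≤ L * Xnorm μ lam K δ c₀ α C D E y := by
  have he := etaC_pos (α := α) hμ hlam hK hδ hc
  set e := etaC μ lam K δ c₀ α with he_def
  refine ⟨(√μ⁻¹)⁻¹ + (√μ)⁻¹ + (√(2 * μ + lam))⁻¹ + (√K⁻¹)⁻¹ + (√(δ ^ 2 / e))⁻¹ + (√e)⁻¹,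
    fun y => ?_⟩
  have hsq := Xnorm_sq (α := α) (C := C) (D := D) (E := E) hμ hlam hK hδ hc y
  have hN := Xnorm_nonneg (μ := μ) (lam := lam) (K := K) (δ := δ) (c₀ := c₀) (α := α)
    (C := C) (D := D) (E := E) y
  rw [← he_def] at hsq
  set N := Xnorm μ lam K δ c₀ α C D E y
  have weaken {k b : ℝ} (hk : 0 < k) (h : k * b ^ 2 ≤ N ^ 2)
      (hle : (√k)⁻¹ ≤ (√μ⁻¹)⁻¹ + (√μ)⁻¹ + (√(2 * μ + lam))⁻¹ + (√K⁻¹)⁻¹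
        + (√(δ ^ 2 / e))⁻¹ + (√e)⁻¹) :
      b ≤ ((√μ⁻¹)⁻¹ + (√μ)⁻¹ + (√(2 * μ + lam))⁻¹ + (√K⁻¹)⁻¹
        + (√(δ ^ 2 / e))⁻¹ + (√e)⁻¹) * N :=
    (le_inv_sqrt_mul_of_mul_sq_le hk hN h).trans (mul_le_mul_of_nonneg_right hle hN)
  have p₁ : 0 ≤ μ⁻¹ * ‖y.1‖ ^ 2 := by positivity
  have p₂ : 0 ≤ μ⁻¹ * ‖C y.1‖ ^ 2 := by positivity
  have p₃ : 0 ≤ μ * ‖y.2.1‖ ^ 2 := by positivity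
  have p₄ : 0 ≤ (2 * μ + lam) * ‖D y.2.1‖ ^ 2 := by positivity
  have p₅ : 0 ≤ K⁻¹ * ‖y.2.2.1‖ ^ 2 := by positivity
  have p₆ : 0 ≤ δ ^ 2 / e * ‖E y.2.2.1‖ ^ 2 := by positivity
  have p₇ : 0 ≤ e * ‖y.2.2.2‖ ^ 2 := by positivity
  have s₁ : 0 ≤ (√μ⁻¹)⁻¹ := by positivity
  have s₂ : 0 ≤ (√μ)⁻¹ := by positivity
  have s₃ : 0 ≤ (√(2 * μ + lam))⁻¹ := by positivity
  have s₄ : 0 ≤ (√K⁻¹)⁻¹ := by positivity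
  have s₅ : 0 ≤ (√(δ ^ 2 / e))⁻¹ := by positivity
  have s₆ : 0 ≤ (√e)⁻¹ := by positivity
  refine ⟨weaken (k := μ⁻¹) ?_ ?_ ?_, weaken (k := μ⁻¹) ?_ ?_ ?_, weaken (k := μ) ?_ ?_ ?_,
    weaken (k := 2 * μ + lam) ?_ ?_ ?_, weaken (k := K⁻¹) ?_ ?_ ?_,
    weaken (k := δ ^ 2 / e) ?_ ?_ ?_, weaken (k := e) ?_ ?_ ?_⟩ <;>
  first | positivity | linarith

lemma eq_zero_of_Xnorm_eq_zero (hμ : 0 < μ) (hlam : 0 < lam) (hK : 0 < K) (hδ : 0 < δ)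
    (hc : 0 ≤ c₀) {x : R × U × Q × P} (h : Xnorm μ lam K δ c₀ α C D E x = 0) : x = 0 := by
  obtain ⟨L, hL⟩ := exists_norm_le_mul_Xnorm (α := α) (C := C) (D := D) (E := E)
    hμ hlam hK hδ hc
  obtain ⟨hr, -, hu, -, hq, -, hp⟩ := hL x
  simp only [h, mul_zero, norm_le_zero_iff] at hr hu hq hp
  simp [Prod.ext_iff, hr, hu, hq, hp]

lemma abs_inner_le_norm_mul {V : Type*} [NormedAddCommGroup V] [InnerProductSpace ℝ V]
    (a : V) {b : V} {t : ℝ} (hb : ‖b‖ ≤ t) : |⟪a, b⟫| ≤ ‖a‖ * t :=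
  (abs_real_inner_le_norm a b).trans (mul_le_mul_of_nonneg_left hb (norm_nonneg a))

lemma two_mul_abs_inner_le {V : Type*} [NormedAddCommGroup V] [InnerProductSpace ℝ V]
    {s : ℝ} (hs : 0 < s) (a b : V) : 2 * |⟪a, b⟫| ≤ s * ‖a‖ ^ 2 + s⁻¹ * ‖b‖ ^ 2 := by
  have h := abs_real_inner_le_norm a b
  have hsq : 0 ≤ s⁻¹ * (s * ‖a‖ - ‖b‖) ^ 2 := by positivity
  have heq : s⁻¹ * (s * ‖a‖ - ‖b‖) ^ 2 = s * ‖a‖ ^ 2 + s⁻¹ * ‖b‖ ^ 2 - 2 * (‖a‖ * ‖b‖) := by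
    field_simp
    ring
  linarith

lemma exists_biotForm_le_mul_Xnorm (hμ : 0 < μ) (hlam : 0 < lam) (hK : 0 < K) (hδ : 0 < δ)
    (hc : 0 ≤ c₀) (x : R × U × Q × P) :
    ∃ B : ℝ, ∀ y : R × U × Q × P,
      biotForm μ lam K δ c₀ α C D E x y ≤ B * Xnorm μ lam K δ c₀ α C D E y := by
  obtain ⟨L, hL⟩ := exists_norm_le_mul_Xnorm (α := α) (C := C) (D := D) (E := E)
    hμ hlam hK hδ hc
  refine ⟨(μ⁻¹ * ‖x.1‖ + (2 * μ + lam) * ‖D x.2.1‖ + K⁻¹ * ‖x.2.2.1‖ + c₀ * ‖x.2.2.2‖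
    + ‖C x.1‖ + ‖α • D x.2.1 + δ • E x.2.2.1‖ + ‖x.2.1‖
    + ‖α • x.2.2.2‖ + ‖δ • x.2.2.2‖) * L, fun y => ?_⟩
  obtain ⟨h₁, h₂, h₃, h₄, h₅, h₆, h₇⟩ := hL y
  have t₁ := mul_le_mul_of_nonneg_left (le_of_abs_le (abs_inner_le_norm_mul x.1 h₁))
    (inv_pos.2 hμ).le
  have t₂ := mul_le_mul_of_nonneg_left (le_of_abs_le (abs_inner_le_norm_mul (D x.2.1) h₄))
    (show 0 ≤ 2 * μ + lam by positivity)
  have t₃ := mul_le_mul_of_nonneg_left (le_of_abs_le (abs_inner_le_norm_mul x.2.2.1 h₅))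
    (inv_pos.2 hK).le
  have t₄ := mul_le_mul_of_nonneg_left (le_of_abs_le (abs_inner_le_norm_mul x.2.2.2 h₇)) hc
  have t₅ := le_of_abs_le (abs_inner_le_norm_mul (C x.1) h₃)
  have t₆ := le_of_abs_le (abs_inner_le_norm_mul (α • D x.2.1 + δ • E x.2.2.1) h₇)
  have t₇ := neg_le_of_abs_le (abs_inner_le_norm_mul x.2.1 h₂)
  have t₈ := neg_le_of_abs_le (abs_inner_le_norm_mul (α • x.2.2.2) h₄)
  have t₉ := neg_le_of_abs_le (abs_inner_le_norm_mul (δ • x.2.2.2) h₆)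
  have e₇ : ⟪C y.1, x.2.1⟫ = ⟪x.2.1, C y.1⟫ := real_inner_comm _ _
  have e₈ : ⟪α • D y.2.1 + δ • E y.2.2.1, x.2.2.2⟫ =
      ⟪α • x.2.2.2, D y.2.1⟫ + ⟪δ • x.2.2.2, E y.2.2.1⟫ := by
    rw [real_inner_comm]
    simp only [inner_add_right, real_inner_smul_left, real_inner_smul_right]
  unfold biotForm
  linarith

/-- The supremum in the inf-sup condition is finite, so that it bounds `𝒜(x, y)/‖y‖_X` for every `y`. -/
lemma biotForm_le_iSup_mul_Xnorm (hμ : 0 < μ) (hlam : 0 < lam) (hK : 0 < K) (hδ : 0 < δ)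
    (hc : 0 ≤ c₀) (x y : R × U × Q × P) :
    biotForm μ lam K δ c₀ α C D E x y ≤
      (⨆ xt : {y : R × U × Q × P // y ≠ 0},
        biotForm μ lam K δ c₀ α C D E x ↑xt / Xnorm μ lam K δ c₀ α C D E ↑xt)
        * Xnorm μ lam K δ c₀ α C D E y := by
  obtain ⟨B, hB⟩ := exists_biotForm_le_mul_Xnorm (α := α) (C := C) (D := D) (E := E)
    hμ hlam hK hδ hc x
  have hbdd : BddAbove (Set.range fun xt : {y : R × U × Q × P // y ≠ 0} =>
      biotForm μ lam K δ c₀ α C D E x ↑xt / Xnorm μ lam K δ c₀ α C D E ↑xt) := by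
    refine ⟨|B|, ?_⟩
    rintro _ ⟨z, rfl⟩
    exact div_le_of_le_mul₀ (Xnorm_nonneg _) (abs_nonneg B)
      ((hB z).trans (mul_le_mul_of_nonneg_right (le_abs_self B) (Xnorm_nonneg _)))
  rcases (Xnorm_nonneg (μ := μ) (lam := lam) (K := K) (δ := δ) (c₀ := c₀) (α := α)
    (C := C) (D := D) (E := E) y).eq_or_lt with h | h
  · simpa [← h] using hB y
  · have hy : y ≠ 0 := by
      rintro rfl
      exact h.ne' Xnorm_zero
    exact (div_le_iff₀ h).1 (le_ciSup hbdd ⟨y, hy⟩)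

lemma Xnorm_le_mul_of_sq_le {t : ℝ} (ht : 0 ≤ t) {x y : R × U × Q × P}
    (h : Xnorm μ lam K δ c₀ α C D E y ^ 2 ≤ t * Xnorm μ lam K δ c₀ α C D E x ^ 2) :
    Xnorm μ lam K δ c₀ α C D E y ≤ (1 + t) * Xnorm μ lam K δ c₀ α C D E x := by
  have hx := Xnorm_nonneg (μ := μ) (lam := lam) (K := K) (δ := δ) (c₀ := c₀) (α := α)
    (C := C) (D := D) (E := E) x
  refine le_of_sq_le_sq (h.trans ?_) (by positivity)
  rw [mul_pow]
  exact mul_le_mul_of_nonneg_right (by nlinarith) (sq_nonneg _)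

lemma biotForm_self (x : R × U × Q × P) :
    biotForm μ lam K δ c₀ α C D E x x =
      μ⁻¹ * ‖x.1‖ ^ 2 + (2 * μ + lam) * ‖D x.2.1‖ ^ 2 + K⁻¹ * ‖x.2.2.1‖ ^ 2
        + c₀ * ‖x.2.2.2‖ ^ 2 := by
  simp only [biotForm, real_inner_self_eq_norm_sq]
  ring

lemma exists_test_projection (hμ : 0 < μ) (hlam : 0 < lam) (hK : 0 < K) (hδ : 0 < δ)
    (hc : 0 ≤ c₀) {β : ℝ} (hβ : 0 < β) (x : R × U × Q × P) {v : U} {s : R}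
    (hv : ⟪v, x.2.1⟫ = ‖v‖ ^ 2) (hs : C s = v) (hbound : β * (‖s‖ ^ 2 + ‖C s‖ ^ 2) ≤ ‖v‖ ^ 2) :
    ∃ y, Xnorm μ lam K δ c₀ α C D E y ≤ (1 + β⁻¹) * Xnorm μ lam K δ c₀ α C D E x ∧
      μ * ‖v‖ ^ 2 / 2 - β⁻¹ * (μ⁻¹ * ‖x.1‖ ^ 2) / 2 ≤ biotForm μ lam K δ c₀ α C D E x y := by
  have he := etaC_pos (α := α) hμ hlam hK hδ hc
  have hvu : ‖v‖ ^ 2 ≤ ‖x.2.1‖ ^ 2 := by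
    have h := real_inner_le_norm v x.2.1
    nlinarith [sq_nonneg (‖v‖ - ‖x.2.1‖)]
  refine ⟨(-(μ • s), 0, 0, 0), Xnorm_le_mul_of_sq_le (by positivity) ?_, ?_⟩
  · rw [Xnorm_sq hμ hlam hK hδ hc, Xnorm_sq hμ hlam hK hδ hc]
    have h₁ : ‖s‖ ^ 2 + ‖C s‖ ^ 2 ≤ β⁻¹ * ‖x.2.1‖ ^ 2 :=
      (le_inv_mul_iff₀ hβ).2 (hbound.trans hvu)
    have h₂ := mul_le_mul_of_nonneg_left h₁ hμ.le
    have h₃ : μ⁻¹ * (‖μ • s‖ ^ 2 + ‖μ • C s‖ ^ 2) = μ * (‖s‖ ^ 2 + ‖C s‖ ^ 2) := by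
      simp only [norm_smul, Real.norm_of_nonneg hμ.le]
      field_simp
    have h₄ : 0 ≤ β⁻¹ * (μ⁻¹ * (‖x.1‖ ^ 2 + ‖C x.1‖ ^ 2)
        + (2 * μ + lam) * ‖D x.2.1‖ ^ 2 + K⁻¹ * ‖x.2.2.1‖ ^ 2
        + δ ^ 2 / etaC μ lam K δ c₀ α * ‖E x.2.2.1‖ ^ 2
        + etaC μ lam K δ c₀ α * ‖x.2.2.2‖ ^ 2) := by positivity
    simp only [map_neg, map_smul, norm_neg, map_zero, norm_zero, h₃]
    linarith
  · have hform : biotForm μ lam K δ c₀ α C D E x (-(μ • s), 0, 0, 0) =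
        μ * ‖v‖ ^ 2 - ⟪x.1, s⟫ := by
      simp only [biotForm, map_neg, map_smul, map_zero, inner_neg_right, inner_neg_left,
        real_inner_smul_right, real_inner_smul_left, inner_zero_right, smul_zero, add_zero,
        inner_zero_left, hs, hv]
      field_simp
      ring
    have hyoung := two_mul_abs_inner_le (show 0 < β⁻¹ * μ⁻¹ by positivity) x.1 s
    rw [mul_inv, inv_inv, inv_inv] at hyoung
    have h₁ : β * ‖s‖ ^ 2 ≤ ‖v‖ ^ 2 := by nlinarith [sq_nonneg ‖C s‖]
    have h₂ := mul_le_mul_of_nonneg_left h₁ hμ.le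
    have h₃ := le_abs_self ⟪x.1, s⟫
    rw [hform]
    linarith

lemma exists_test_curl (hμ : 0 < μ) (hlam : 0 < lam) (hK : 0 < K) (hδ : 0 < δ)
    (hc : 0 ≤ c₀) (x : R × U × Q × P) (hDC : D (C x.1) = 0) :
    ∃ y, Xnorm μ lam K δ c₀ α C D E y ≤ (1 + 1) * Xnorm μ lam K δ c₀ α C D E x ∧
      μ⁻¹ * ‖C x.1‖ ^ 2 ≤ biotForm μ lam K δ c₀ α C D E x y := by
  have he := etaC_pos (α := α) hμ hlam hK hδ hc
  refine ⟨(0, μ⁻¹ • C x.1, 0, 0), Xnorm_le_mul_of_sq_le zero_le_one ?_, ?_⟩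
  · rw [Xnorm_sq hμ hlam hK hδ hc, Xnorm_sq hμ hlam hK hδ hc]
    have h₁ : μ * ‖μ⁻¹ • C x.1‖ ^ 2 = μ⁻¹ * ‖C x.1‖ ^ 2 := by
      simp only [norm_smul, norm_inv, Real.norm_of_nonneg hμ.le]
      field_simp
    have h₂ : 0 ≤ μ⁻¹ * ‖x.1‖ ^ 2 + μ * ‖x.2.1‖ ^ 2
        + (2 * μ + lam) * ‖D x.2.1‖ ^ 2 + K⁻¹ * ‖x.2.2.1‖ ^ 2
        + δ ^ 2 / etaC μ lam K δ c₀ α * ‖E x.2.2.1‖ ^ 2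
        + etaC μ lam K δ c₀ α * ‖x.2.2.2‖ ^ 2 := by positivity
    simp only [h₁, map_smul, hDC, smul_zero, map_zero, norm_zero]
    linarith
  · simp [biotForm, hDC, real_inner_smul_right]

lemma exists_test_flux_divergence (hμ : 0 < μ) (hlam : 0 < lam) (hK : 0 < K) (hδ : 0 < δ)
    (hc : 0 ≤ c₀) (x : R × U × Q × P) :
    ∃ y, Xnorm μ lam K δ c₀ α C D E y ≤ (1 + 1) * Xnorm μ lam K δ c₀ α C D E x ∧
      δ ^ 2 / etaC μ lam K δ c₀ α * ‖E x.2.2.1‖ ^ 2 / 2 - (2 * μ + lam) * ‖D x.2.1‖ ^ 2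
        - c₀ * ‖x.2.2.2‖ ^ 2 ≤ biotForm μ lam K δ c₀ α C D E x y := by
  have he := etaC_pos (α := α) hμ hlam hK hδ hc
  have hw : 0 < 2 * μ + lam := by positivity
  have hαe : α ^ 2 / etaC μ lam K δ c₀ α ≤ 2 * μ + lam := by
    rw [div_le_iff₀ he, ← div_le_iff₀' hw, etaC]
    have : 0 ≤ δ ^ 2 * K := by positivity
    linarith
  have hce : c₀ ^ 2 / etaC μ lam K δ c₀ α ≤ c₀ := by
    rw [div_le_iff₀ he, sq]
    refine mul_le_mul_of_nonneg_left ?_ hc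
    have : 0 ≤ α ^ 2 / (2 * μ + lam) + δ ^ 2 * K := by positivity
    unfold etaC
    linarith
  refine ⟨(0, 0, 0, (δ / etaC μ lam K δ c₀ α) • E x.2.2.1),
    Xnorm_le_mul_of_sq_le zero_le_one ?_, ?_⟩
  · rw [Xnorm_sq hμ hlam hK hδ hc, Xnorm_sq hμ hlam hK hδ hc]
    set e := etaC μ lam K δ c₀ α
    have h₁ : e * ‖(δ / e) • E x.2.2.1‖ ^ 2 = δ ^ 2 / e * ‖E x.2.2.1‖ ^ 2 := by
      rw [norm_smul, Real.norm_of_nonneg (by positivity)]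
      field_simp
    have h₂ : 0 ≤ μ⁻¹ * (‖x.1‖ ^ 2 + ‖C x.1‖ ^ 2) + μ * ‖x.2.1‖ ^ 2
        + (2 * μ + lam) * ‖D x.2.1‖ ^ 2 + K⁻¹ * ‖x.2.2.1‖ ^ 2
        + e * ‖x.2.2.2‖ ^ 2 := by positivity
    simp only [h₁, map_zero, norm_zero]
    linarith
  · set e := etaC μ lam K δ c₀ α
    have hform : biotForm μ lam K δ c₀ α C D E x (0, 0, 0, (δ / e) • E x.2.2.1) =
        δ ^ 2 / e * ‖E x.2.2.1‖ ^ 2 + ⟪α • D x.2.1, (δ / e) • E x.2.2.1⟫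
          + ⟪c₀ • x.2.2.2, (δ / e) • E x.2.2.1⟫ := by
      simp only [biotForm, map_zero, real_inner_smul_right, real_inner_smul_left,
        inner_zero_right, smul_zero, add_zero, inner_zero_left, inner_add_left,
        real_inner_self_eq_norm_sq]
      ring
    have y₁ := two_mul_abs_inner_le (show 0 < 2 / e by positivity)
      (α • D x.2.1) ((δ / e) • E x.2.2.1)
    have y₂ := two_mul_abs_inner_le (show 0 < 2 / e by positivity)
      (c₀ • x.2.2.2) ((δ / e) • E x.2.2.1)
    have e₁ : 2 / e * ‖α • D x.2.1‖ ^ 2 = 2 * (α ^ 2 / e * ‖D x.2.1‖ ^ 2) := by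
      rw [norm_smul, mul_pow, Real.norm_eq_abs, sq_abs]
      ring
    have e₂ : 2 / e * ‖c₀ • x.2.2.2‖ ^ 2 = 2 * (c₀ ^ 2 / e * ‖x.2.2.2‖ ^ 2) := by
      rw [norm_smul, mul_pow, Real.norm_eq_abs, sq_abs]
      ring
    have e₃ : (2 / e)⁻¹ * ‖(δ / e) • E x.2.2.1‖ ^ 2 = δ ^ 2 / e * ‖E x.2.2.1‖ ^ 2 / 2 := by
      rw [norm_smul, mul_pow, Real.norm_eq_abs, sq_abs]
      field_simp
    rw [e₁, e₃] at y₁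
    rw [e₂, e₃] at y₂
    have m₁ := mul_le_mul_of_nonneg_right hαe (sq_nonneg ‖D x.2.1‖)
    have m₂ := mul_le_mul_of_nonneg_right hce (sq_nonneg ‖x.2.2.2‖)
    have n₁ := neg_abs_le ⟪α • D x.2.1, (δ / e) • E x.2.2.1⟫
    have n₂ := neg_abs_le ⟪c₀ • x.2.2.2, (δ / e) • E x.2.2.1⟫
    rw [hform]
    linarith

lemma exists_test_displacement_lift (hμ : 0 < μ) (hlam : 0 < lam) (hK : 0 < K) (hδ : 0 < δ)
    (hc : 0 ≤ c₀) {β : ℝ} (hβ : 0 < β) (x : R × U × Q × P) {v : U} (hv : D v = x.2.2.2)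
    (horth : ⟪C x.1, v⟫ = 0) (hbound : β * (‖v‖ ^ 2 + ‖D v‖ ^ 2) ≤ ‖x.2.2.2‖ ^ 2) :
    ∃ y, Xnorm μ lam K δ c₀ α C D E y ≤ (1 + β⁻¹) * Xnorm μ lam K δ c₀ α C D E x ∧
      α ^ 2 / (2 * μ + lam) * ‖x.2.2.2‖ ^ 2 / 2 - (2 * μ + lam) * ‖D x.2.1‖ ^ 2 / 2 ≤
        biotForm μ lam K δ c₀ α C D E x y := by
  have he := etaC_pos (α := α) hμ hlam hK hδ hc
  have hw : 0 < 2 * μ + lam := by positivity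
  have hαe : α ^ 2 / (2 * μ + lam) ≤ etaC μ lam K δ c₀ α := by
    have : 0 ≤ δ ^ 2 * K := by positivity
    unfold etaC
    linarith
  have hμw : μ ≤ 2 * μ + lam := by linarith
  refine ⟨(0, -((α / (2 * μ + lam)) • v), 0, 0), Xnorm_le_mul_of_sq_le (by positivity) ?_, ?_⟩
  · rw [Xnorm_sq hμ hlam hK hδ hc, Xnorm_sq hμ hlam hK hδ hc]
    set e := etaC μ lam K δ c₀ α
    set w := 2 * μ + lam
    have h₁ : w * ‖(α / w) • v‖ ^ 2 + w * ‖(α / w) • D v‖ ^ 2 =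
        α ^ 2 / w * (‖v‖ ^ 2 + ‖D v‖ ^ 2) := by
      simp only [norm_smul, mul_pow, Real.norm_eq_abs, sq_abs]
      field_simp
    have h₂ := mul_le_mul_of_nonneg_right hμw (sq_nonneg ‖(α / w) • v‖)
    have h₃ := mul_le_mul_of_nonneg_left ((le_inv_mul_iff₀ hβ).2 hbound)
      (show 0 ≤ α ^ 2 / w by positivity)
    have h₄ := mul_le_mul_of_nonneg_right hαe (show 0 ≤ β⁻¹ * ‖x.2.2.2‖ ^ 2 by positivity)
    have h₅ : 0 ≤ β⁻¹ * (μ⁻¹ * (‖x.1‖ ^ 2 + ‖C x.1‖ ^ 2) + μ * ‖x.2.1‖ ^ 2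
        + w * ‖D x.2.1‖ ^ 2 + K⁻¹ * ‖x.2.2.1‖ ^ 2
        + δ ^ 2 / e * ‖E x.2.2.1‖ ^ 2) := by positivity
    simp only [map_neg, map_smul, norm_neg, map_zero, norm_zero]
    linarith
  · set w := 2 * μ + lam with hw_def
    have hform : biotForm μ lam K δ c₀ α C D E x (0, -((α / w) • v), 0, 0) =
        α ^ 2 / w * ‖x.2.2.2‖ ^ 2 - ⟪D x.2.1, α • x.2.2.2⟫ := by
      simp only [biotForm, map_neg, map_smul, map_zero, inner_neg_right, inner_neg_left,
        real_inner_smul_right, real_inner_smul_left, inner_zero_right, smul_zero, add_zero,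
        inner_zero_left, hv, horth, smul_neg, real_inner_self_eq_norm_sq, ← hw_def]
      field_simp
      ring
    have y₁ := two_mul_abs_inner_le hw (D x.2.1) (α • x.2.2.2)
    have e₁ : w⁻¹ * ‖α • x.2.2.2‖ ^ 2 = α ^ 2 / w * ‖x.2.2.2‖ ^ 2 := by
      rw [norm_smul, mul_pow, Real.norm_eq_abs, sq_abs]
      ring
    rw [e₁] at y₁
    have n₁ := le_abs_self ⟪D x.2.1, α • x.2.2.2⟫
    rw [hform]
    linarith

lemma exists_test_flux_lift (hμ : 0 < μ) (hlam : 0 < lam) (hK : 0 < K) (hδ : 0 < δ)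
    (hc : 0 ≤ c₀) {β : ℝ} (hβ : 0 < β) (x : R × U × Q × P) {v : Q} (hv : E v = x.2.2.2)
    (hbound : β * (‖v‖ ^ 2 + ‖E v‖ ^ 2) ≤ ‖x.2.2.2‖ ^ 2) :
    ∃ y, Xnorm μ lam K δ c₀ α C D E y ≤ (1 + β⁻¹) * Xnorm μ lam K δ c₀ α C D E x ∧
      δ ^ 2 * K * ‖x.2.2.2‖ ^ 2 / 2 - β⁻¹ * (K⁻¹ * ‖x.2.2.1‖ ^ 2) / 2 ≤
        biotForm μ lam K δ c₀ α C D E x y := by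
  have he := etaC_pos (α := α) hμ hlam hK hδ hc
  have hδe : δ ^ 2 * K ≤ etaC μ lam K δ c₀ α := by
    have : 0 ≤ α ^ 2 / (2 * μ + lam) := by positivity
    unfold etaC
    linarith
  refine ⟨(0, 0, -((δ * K) • v), 0), Xnorm_le_mul_of_sq_le (by positivity) ?_, ?_⟩
  · rw [Xnorm_sq hμ hlam hK hδ hc, Xnorm_sq hμ hlam hK hδ hc]
    set e := etaC μ lam K δ c₀ α
    have h₁ : K⁻¹ * ‖(δ * K) • v‖ ^ 2 = δ ^ 2 * K * ‖v‖ ^ 2 := by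
      simp only [norm_smul, mul_pow, Real.norm_eq_abs, sq_abs]
      field_simp
    have h₂ : δ ^ 2 / e * ‖(δ * K) • E v‖ ^ 2 ≤ δ ^ 2 * K * ‖E v‖ ^ 2 := by
      have hquot : δ ^ 2 * K / e ≤ 1 := (div_le_one he).2 hδe
      have hmul := mul_le_mul_of_nonneg_right hquot
        (show 0 ≤ δ ^ 2 * K * ‖E v‖ ^ 2 by positivity)
      simp only [norm_smul, mul_pow, Real.norm_eq_abs, sq_abs]
      calc δ ^ 2 / e * (δ ^ 2 * K ^ 2 * ‖E v‖ ^ 2)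
          = δ ^ 2 * K / e * (δ ^ 2 * K * ‖E v‖ ^ 2) := by ring
        _ ≤ δ ^ 2 * K * ‖E v‖ ^ 2 := by linarith
    have h₃ := mul_le_mul_of_nonneg_left ((le_inv_mul_iff₀ hβ).2 hbound)
      (show 0 ≤ δ ^ 2 * K by positivity)
    have h₄ := mul_le_mul_of_nonneg_right hδe (show 0 ≤ β⁻¹ * ‖x.2.2.2‖ ^ 2 by positivity)
    have h₅ : 0 ≤ β⁻¹ * (μ⁻¹ * (‖x.1‖ ^ 2 + ‖C x.1‖ ^ 2) + μ * ‖x.2.1‖ ^ 2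
        + (2 * μ + lam) * ‖D x.2.1‖ ^ 2 + K⁻¹ * ‖x.2.2.1‖ ^ 2
        + δ ^ 2 / e * ‖E x.2.2.1‖ ^ 2) := by positivity
    simp only [map_neg, map_smul, norm_neg, map_zero, norm_zero]
    linarith
  · have hform : biotForm μ lam K δ c₀ α C D E x (0, 0, -((δ * K) • v), 0) =
        δ ^ 2 * K * ‖x.2.2.2‖ ^ 2 - δ * ⟪x.2.2.1, v⟫ := by
      simp only [biotForm, map_neg, map_smul, map_zero, inner_neg_right, inner_neg_left,
        real_inner_smul_right, real_inner_smul_left, inner_zero_right, smul_zero, zero_add,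
        inner_zero_left, hv, smul_neg, real_inner_self_eq_norm_sq]
      field_simp
      ring
    have y₁ := mul_le_mul_of_nonneg_left
      (two_mul_abs_inner_le (show 0 < β⁻¹ * (δ * K)⁻¹ by positivity) x.2.2.1 v) hδ.le
    have e₁ : δ * (β⁻¹ * (δ * K)⁻¹ * ‖x.2.2.1‖ ^ 2 + (β⁻¹ * (δ * K)⁻¹)⁻¹ * ‖v‖ ^ 2) =
        β⁻¹ * (K⁻¹ * ‖x.2.2.1‖ ^ 2) + δ ^ 2 * K * (β * ‖v‖ ^ 2) := by
      field_simp
    rw [e₁] at y₁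
    have h₁ : β * ‖v‖ ^ 2 ≤ ‖x.2.2.2‖ ^ 2 := by nlinarith [sq_nonneg ‖E v‖]
    have h₂ := mul_le_mul_of_nonneg_left h₁ (show 0 ≤ δ ^ 2 * K by positivity)
    have h₃ := mul_le_mul_of_nonneg_left (le_abs_self ⟪x.2.2.1, v⟫) hδ.le
    rw [hform]
    linarith

end Auxiliary

/-- Inf-sup, Lemma 3.3: there exists `γ > 0`, independent of the material
parameters `μ, λ, K, δ, c₀, α`, such that for every `x ∈ X` the supremum of
`𝒜(x, xt)/‖xt‖_X` over nonzero `xt ∈ X` is at least `γ‖x‖_X`. -/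
theorem biotForm_infsup
    (C : R →ₗ[ℝ] U) (D : U →ₗ[ℝ] P) (E : Q →ₗ[ℝ] P)
    (hrange : LinearMap.range C = LinearMap.ker D)
    (Pi : U →ₗ[ℝ] U)
    (hPi_idem : ∀ u : U, Pi (Pi u) = Pi u)
    (hPi_symm : ∀ u v : U, ⟪Pi u, v⟫ = ⟪u, Pi v⟫)
    (hPi_range : LinearMap.range Pi = LinearMap.range C)
    (αu : ℝ) (hαu : 0 < αu)
    (hPoin : ∀ u : U, Pi u = 0 → αu * ‖u‖ ≤ ‖D u‖)
    (βr βu βq : ℝ) (hβr : 0 < βr) (hβu : 0 < βu) (hβq : 0 < βq)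
    (hlift_r : ∀ u : U, ∃ r : R, C r = Pi u ∧ βr * (‖r‖ ^ 2 + ‖C r‖ ^ 2) ≤ ‖Pi u‖ ^ 2)
    (hlift_u : ∀ p : P, ∃ u : U, D u = p ∧ Pi u = 0 ∧ βu * (‖u‖ ^ 2 + ‖D u‖ ^ 2) ≤ ‖p‖ ^ 2)
    (hlift_q : ∀ p : P, ∃ q : Q, E q = p ∧ βq * (‖q‖ ^ 2 + ‖E q‖ ^ 2) ≤ ‖p‖ ^ 2)
    :
    ∃ γ > (0 : ℝ),
      ∀ μ lam K δ c₀ α : ℝ, 0 < μ → 0 < lam → 0 < K → 0 < δ → 0 ≤ c₀ →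
        ∀ x : R × U × Q × P,
          γ * Xnorm μ lam K δ c₀ α C D E x ≤
            ⨆ xt : {y : R × U × Q × P // y ≠ 0},
              biotForm μ lam K δ c₀ α C D E x ↑xt / Xnorm μ lam K δ c₀ α C D E ↑xt := by
  set M : ℝ := 2 + αu⁻¹ ^ 2 + βr⁻¹ / 2 + βq⁻¹ / 2 with hM_def
  have hr_inv : 0 < βr⁻¹ := inv_pos.2 hβr
  have hu_inv : 0 < βu⁻¹ := inv_pos.2 hβu
  have hq_inv : 0 < βq⁻¹ := inv_pos.2 hβq
  have hM : 0 < M := by positivity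
  set G : ℝ := M + (1 + βr⁻¹) + (1 + 1) + (1 + 1) + (1 + βu⁻¹) + (1 + βq⁻¹) with hG_def
  have hG : 0 < G := by positivity
  refine ⟨1 / (2 * G), by positivity, ?_⟩
  intro μ lam K δ c₀ α hμ hlam hK hδ hc x
  rcases eq_or_ne x 0 with rfl | hx
  · simp [Xnorm_zero, biotForm]
  have hform := biotForm_le_iSup_mul_Xnorm (α := α) (C := C) (D := D) (E := E)
    hμ hlam hK hδ hc x
  set S := ⨆ xt : {y : R × U × Q × P // y ≠ 0},
    biotForm μ lam K δ c₀ α C D E x ↑xt / Xnorm μ lam K δ c₀ α C D E ↑xt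
  have hNsq := Xnorm_sq (α := α) (C := C) (D := D) (E := E) hμ hlam hK hδ hc x
  have hN := Xnorm_nonneg (μ := μ) (lam := lam) (K := K) (δ := δ) (c₀ := c₀) (α := α)
    (C := C) (D := D) (E := E) x
  have hDC (r : R) : D (C r) = 0 := by
    have : C r ∈ LinearMap.ker D := hrange ▸ LinearMap.mem_range_self C r
    exact this
  have hDPi (u : U) : D (Pi u) = 0 := by
    have : Pi u ∈ LinearMap.range C := hPi_range ▸ LinearMap.mem_range_self Pi u
    obtain ⟨r, hr⟩ := this
    rw [← hr, hDC]
  have hPi_self (u : U) : ⟪Pi u, u⟫ = ‖Pi u‖ ^ 2 := by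
    rw [← real_inner_self_eq_norm_sq, hPi_symm u (Pi u), hPi_idem, real_inner_comm]
  have horth (r : R) (v : U) (hv : Pi v = 0) : ⟪C r, v⟫ = 0 := by
    have : C r ∈ LinearMap.range Pi := hPi_range ▸ LinearMap.mem_range_self C r
    obtain ⟨u, hu⟩ := this
    rw [← hu, hPi_symm, hv, inner_zero_right]
  -- The displacement splits orthogonally, and the Poincaré inequality controls its second part.
  have hsplit : ‖x.2.1‖ ^ 2 = ‖Pi x.2.1‖ ^ 2 + ‖x.2.1 - Pi x.2.1‖ ^ 2 := by
    rw [norm_sub_sq_real, real_inner_comm, hPi_self]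
    ring
  have hpoin : ‖x.2.1 - Pi x.2.1‖ ^ 2 ≤ αu⁻¹ ^ 2 * ‖D x.2.1‖ ^ 2 := by
    have h := hPoin (x.2.1 - Pi x.2.1) (by rw [map_sub, hPi_idem, sub_self])
    rw [map_sub, hDPi, sub_zero] at h
    rw [← mul_pow]
    exact pow_le_pow_left₀ (norm_nonneg _) ((le_inv_mul_iff₀ hαu).2 h) 2
  have hu_bound : μ * ‖x.2.1‖ ^ 2 / 2 ≤
      μ * ‖Pi x.2.1‖ ^ 2 / 2 + αu⁻¹ ^ 2 * ((2 * μ + lam) * ‖D x.2.1‖ ^ 2) := by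
    have h₁ := mul_le_mul_of_nonneg_left hpoin hμ.le
    have h₂ : 0 ≤ αu⁻¹ ^ 2 * ((μ + lam) * ‖D x.2.1‖ ^ 2) := by positivity
    have h₃ : 0 ≤ αu⁻¹ ^ 2 * (μ * ‖D x.2.1‖ ^ 2) := by positivity
    rw [hsplit]
    linarith
  have hself := hform x
  rw [biotForm_self] at hself
  set N := Xnorm μ lam K δ c₀ α C D E x
  have hN_pos : 0 < N := hN.lt_of_ne' (mt (eq_zero_of_Xnorm_eq_zero hμ hlam hK hδ hc) hx)
  have hS0 : 0 ≤ S := nonneg_of_mul_nonneg_left (le_trans (by positivity) hself) hN_pos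
  have htest {y : R × U × Q × P} {k b : ℝ} (hy : Xnorm μ lam K δ c₀ α C D E y ≤ k * N)
      (hb : b ≤ biotForm μ lam K δ c₀ α C D E x y) : b ≤ k * (S * N) := by
    have h := mul_le_mul_of_nonneg_left hy hS0
    linarith [hform y]
  obtain ⟨s, hs, hs_bound⟩ := hlift_r x.2.1
  obtain ⟨v, hv, hPv, hv_bound⟩ := hlift_u x.2.2.2
  obtain ⟨z, hz, hz_bound⟩ := hlift_q x.2.2.2
  obtain ⟨_, hn₁, hf₁⟩ := exists_test_projection (α := α) (D := D) (E := E)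
    hμ hlam hK hδ hc hβr x (hPi_self _) hs hs_bound
  obtain ⟨_, hn₂, hf₂⟩ := exists_test_curl (α := α) (E := E) hμ hlam hK hδ hc x (hDC _)
  obtain ⟨_, hn₃, hf₃⟩ := exists_test_flux_divergence (α := α) (C := C) (D := D) (E := E)
    hμ hlam hK hδ hc x
  obtain ⟨_, hn₄, hf₄⟩ := exists_test_displacement_lift (α := α) (E := E)
    hμ hlam hK hδ hc hβu x hv (horth _ v hPv) hv_bound
  obtain ⟨_, hn₅, hf₅⟩ := exists_test_flux_lift (α := α) (C := C) (D := D)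
    hμ hlam hK hδ hc hβq x hz hz_bound
  have t₀ := mul_le_mul_of_nonneg_left hself hM.le
  have t₁ := htest hn₁ hf₁
  have t₂ := htest hn₂ hf₂
  have t₃ := htest hn₃ hf₃
  have t₄ := htest hn₄ hf₄
  have t₅ := htest hn₅ hf₅
  have hetaC : etaC μ lam K δ c₀ α * ‖x.2.2.2‖ ^ 2 =
      α ^ 2 / (2 * μ + lam) * ‖x.2.2.2‖ ^ 2 + δ ^ 2 * K * ‖x.2.2.2‖ ^ 2
        + c₀ * ‖x.2.2.2‖ ^ 2 := by
    unfold etaC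
    ring
  have hmain : N ^ 2 / 2 ≤ G * (S * N) := by
    have pr : 0 ≤ μ⁻¹ * ‖x.1‖ ^ 2 := by positivity
    have pc : 0 ≤ μ⁻¹ * ‖C x.1‖ ^ 2 := by positivity
    have pd : 0 ≤ (2 * μ + lam) * ‖D x.2.1‖ ^ 2 := by positivity
    have pq : 0 ≤ K⁻¹ * ‖x.2.2.1‖ ^ 2 := by positivity
    have pp : 0 ≤ c₀ * ‖x.2.2.2‖ ^ 2 := by positivity
    have g₁ := mul_nonneg hr_inv.le pd
    have g₂ := mul_nonneg hq_inv.le pd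
    have g₃ := mul_nonneg (sq_nonneg αu⁻¹) pr
    have g₄ := mul_nonneg hq_inv.le pr
    have g₅ := mul_nonneg (sq_nonneg αu⁻¹) pq
    have g₆ := mul_nonneg hr_inv.le pq
    have g₇ := mul_nonneg (sq_nonneg αu⁻¹) pp
    have g₈ := mul_nonneg hr_inv.le pp
    have g₉ := mul_nonneg hq_inv.le pp
    rw [hM_def] at t₀
    rw [hNsq, hetaC, hG_def, hM_def]
    linarith
  have hNS : N / 2 ≤ G * S := by
    refine le_of_mul_le_mul_right ?_ hN_pos
    linarith
  rw [one_div, inv_mul_eq_div, div_le_iff₀ (by positivity)]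
  linarith
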